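/- Strong duality for signed tropical linear regression: min over a ∈ (Rmax)^n with a ≠ ⊥ of dist_H(𝒱, H^{IJ}_a) = −ρ(T^{IJ}) = sup{r ≥ 0 : ∃ w ∈ R^n, B_{IJ}(w, r) ⊆ Sp(𝒱)}. The minimum is attained: there exists b ≠ ⊥ with T^{IJ}(b) ≥ ρ(T^{IJ}) + b, and every such b attains the minimum. Moreover, if ρ(T^{IJ}) is finite, the supremum is attained: there exists c ∈ R^n with B_{IJ}(c, −ρ(T^{IJ})) ⊆ Sp(𝒱). -/

import Mathlib

open scoped Classical BigOperators

noncomputable section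

namespace TropReg

/-- `x` is a vector of `Rmax = ℝ ∪ {-∞}`, modeled inside `EReal` as having no `+∞` entry. -/
def IsRmax {n : ℕ} (x : Fin n → EReal) : Prop := ∀ i, x i ≠ ⊤

/-- Embedding of a real vector into `(Rmax)^n`. -/
def ofReal {n : ℕ} (a : Fin n → ℝ) : Fin n → EReal := fun i => (a i : EReal)

/-- Hilbert's projective metric on `(Rmax)^n`, with values in `[0,+∞] ⊆ EReal`;
`d(⊥,⊥) = 0` by convention, and the infimum of the empty set is `+∞`. -/
def hd {n : ℕ} (x y : Fin n → EReal) : EReal :=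
  if x = ⊥ ∧ y = ⊥ then 0
  else sInf { t : EReal | ∃ lam mu : ℝ, t = (lam : EReal) - (mu : EReal) ∧
        (∀ i, (mu : EReal) + y i ≤ x i) ∧ (∀ i, x i ≤ (lam : EReal) + y i) }

/-- Closed Hilbert ball of center `a` and radius `r`, inside `(Rmax)^n`. -/
def ball {n : ℕ} (a : Fin n → EReal) (r : EReal) : Set (Fin n → EReal) :=
  { x | IsRmax x ∧ hd a x ≤ r }

/-- Hilbert distance from a point to a set. -/
def distPt {n : ℕ} (x : Fin n → EReal) (B : Set (Fin n → EReal)) : EReal :=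
  ⨅ b ∈ B, hd x b

/-- One-sided Hausdorff distance from `A` to `B` for Hilbert's metric. -/
def distHS {n : ℕ} (A B : Set (Fin n → EReal)) : EReal :=
  ⨆ a ∈ A, distPt a B

/-- Tropical hyperplane associated with `a`: the maximum `max_i (a_i + x_i)` is
attained at least twice. -/
def hyper {n : ℕ} (a : Fin n → EReal) : Set (Fin n → EReal) :=
  { x | IsRmax x ∧ ∃ i j : Fin n, i ≠ j ∧
      a i + x i = (⨆ k, a k + x k) ∧ a j + x j = (⨆ k, a k + x k) }

/-- Tropical column space of the matrix `V`. -/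
def colSpace {n p : ℕ} (V : Fin n → Fin p → EReal) : Set (Fin n → EReal) :=
  { y | ∃ x : Fin p → EReal, IsRmax x ∧ y = fun i => ⨆ k, (V i k + x k) }

/-- The `k`-th column of `V`. -/
def col {n p : ℕ} (V : Fin n → Fin p → EReal) (k : Fin p) : Fin n → EReal :=
  fun i => V i k

/-- The set of columns of `V`. -/
def cols {n p : ℕ} (V : Fin n → Fin p → EReal) : Set (Fin n → EReal) :=
  Set.range (col V)

/-- The Shapley operator associated with the matrix `V`. -/
def TV {n p : ℕ} (V : Fin n → Fin p → EReal) (x : Fin n → EReal) : Fin n → EReal :=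
  fun i => ⨅ k ∈ { k : Fin p | V i k ≠ ⊥ },
    (-(V i k) + ⨆ j ∈ { j : Fin n | j ≠ i }, (V j k + x j))

/-- Tropical spectral radius of an operator `T`. -/
def rho {n : ℕ} (T : (Fin n → EReal) → (Fin n → EReal)) : EReal :=
  sSup { lam : EReal | lam ≠ ⊤ ∧ ∃ u : Fin n → EReal, IsRmax u ∧ u ≠ ⊥ ∧
      T u = fun i => lam + u i }

/-- Tropical convex cone in `(Rmax)^n`. -/
def IsTropCone {n : ℕ} (C : Set (Fin n → EReal)) : Prop :=
  (∀ x ∈ C, ∀ y ∈ C, (fun i => x i ⊔ y i) ∈ C) ∧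
  (∀ x ∈ C, ∀ lam : EReal, lam ≠ ⊤ → (fun i => lam + x i) ∈ C)

/-- Tropical span: smallest tropical cone containing `Vs`. -/
def span {n : ℕ} (Vs : Set (Fin n → EReal)) : Set (Fin n → EReal) :=
  ⋂₀ { C | IsTropCone C ∧ Vs ⊆ C }

/-- Inner radius: supremum of radii of Hilbert balls centered at finite points
included in `W`. -/
def inradius {n : ℕ} (W : Set (Fin n → EReal)) : EReal :=
  sSup { r : EReal | ∃ s : ℝ, r = (s : EReal) ∧ 0 ≤ s ∧
      ∃ a : Fin n → ℝ, ball (ofReal a) r ⊆ W }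


/-- Signed tropical hyperplane of type `(I,J)`. -/
def shyper {n : ℕ} (I J : Set (Fin n)) (a : Fin n → EReal) : Set (Fin n → EReal) :=
  { x | IsRmax x ∧ (⨆ i ∈ I, (a i + x i)) = ⨆ j ∈ J, (a j + x j) }

/-- The Shapley operator `T^{IJ}` associated with the point set `Vs` and the
type `(I,J)`. -/
def TIJ {n : ℕ} (I J : Set (Fin n)) (Vs : Set (Fin n → EReal))
    (x : Fin n → EReal) : Fin n → EReal :=
  fun l =>
    if l ∈ I then
      ⨅ v ∈ { v ∈ Vs | v l ≠ ⊥ }, (-(v l) + ⨆ j ∈ J, (v j + x j))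
    else
      ⨅ v ∈ { v ∈ Vs | v l ≠ ⊥ }, (-(v l) + ⨆ i ∈ I, (v i + x i))

/-- Tropical spectral radius of an operator `T`. -/
def rhoOp {n : ℕ} (T : (Fin n → EReal) → (Fin n → EReal)) : EReal :=
  sSup { lam : EReal | lam ≠ ⊤ ∧ ∃ u : Fin n → EReal, IsRmax u ∧ u ≠ ⊥ ∧
      T u = fun i => lam + u i }

/-- Vertical interval of type `(I,J)`, centered at `w ∈ ℝ^n` and of radius `r`:
`B_{IJ}(w,r) = { λ + w + μ e^J : λ ∈ ℝ, μ ∈ [-r,r] }`. -/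
def vinterval {n : ℕ} (J : Set (Fin n)) (w : Fin n → ℝ) (r : EReal) :
    Set (Fin n → EReal) :=
  { y | ∃ lam mu : ℝ, -r ≤ (mu : EReal) ∧ (mu : EReal) ≤ r ∧
      y = ofReal (fun l => lam + w l + (if l ∈ J then mu else 0)) }

section SignedDuality

variable {n : ℕ}

lemma coe_add_le_iff (c : ℝ) (a b : EReal) :
    (c : EReal) + a ≤ b ↔ a ≤ ((-c : ℝ) : EReal) + b := by
  induction a <;> induction b <;> simp [← EReal.coe_add, -EReal.coe_neg]

lemma coe_add_coe_add (c d : ℝ) (a : EReal) :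
    (c : EReal) + ((d : EReal) + a) = ((c + d : ℝ) : EReal) + a := by
  rw [← add_assoc, EReal.coe_add]

lemma le_coe_add_iff (c : ℝ) (a b : EReal) :
    a ≤ (c : EReal) + b ↔ ((-c : ℝ) : EReal) + a ≤ b := by
  rw [coe_add_le_iff, neg_neg]

/-- The max-plus scalar product of `v` and `x` restricted to the coordinates in `S`. -/
def bsup (S : Set (Fin n)) (v x : Fin n → EReal) : EReal := ⨆ j ∈ S, (v j + x j)

lemma bsup_le_iff {S : Set (Fin n)} {v x : Fin n → EReal} {b : EReal} :
    bsup S v x ≤ b ↔ ∀ j ∈ S, v j + x j ≤ b := iSup₂_le_iff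

lemma le_bsup {S : Set (Fin n)} (v x : Fin n → EReal) {j : Fin n} (hj : j ∈ S) :
    v j + x j ≤ bsup S v x := le_iSup₂ (f := fun j _ => v j + x j) j hj

lemma bsup_comm (S : Set (Fin n)) (v x : Fin n → EReal) : bsup S v x = bsup S x v := by
  simp only [bsup, add_comm]

lemma bsup_mono {S : Set (Fin n)} (v : Fin n → EReal) {x y : Fin n → EReal} (h : x ≤ y) :
    bsup S v x ≤ bsup S v y :=
  bsup_le_iff.2 fun _ hj => (add_le_add_right (h _) _).trans (le_bsup v y hj)

lemma bsup_add (S : Set (Fin n)) (v x : Fin n → EReal) (c : ℝ) :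
    bsup S v (fun i => (c : EReal) + x i) = (c : EReal) + bsup S v x := by
  apply le_antisymm
  · refine bsup_le_iff.2 fun j hj => ?_
    rw [add_left_comm]
    exact add_le_add_right (le_bsup v x hj) _
  · rw [coe_add_le_iff]
    refine bsup_le_iff.2 fun j hj => ?_
    rw [← coe_add_le_iff, add_left_comm]
    exact le_bsup v (fun i => (c : EReal) + x i) hj

lemma bsup_ne_top {S : Set (Fin n)} {v x : Fin n → EReal} (hv : IsRmax v) (hx : IsRmax x) :
    bsup S v x ≠ ⊤ := by
  have h : ∀ j, (⨆ _ : j ∈ S, (v j + x j)) < ⊤ := fun j => by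
    by_cases hj : j ∈ S
    · simpa [hj] using (EReal.add_lt_top (hv j) (hx j))
    · simp [hj]
  unfold bsup
  by_cases hn : Nonempty (Fin n)
  · obtain ⟨j, hj⟩ := exists_eq_ciSup_of_finite (f := fun j => ⨆ _ : j ∈ S, (v j + x j))
    rw [← hj]
    exact (h j).ne
  · have := not_nonempty_iff.1 hn
    simp

lemma exists_coe_eq {v : Fin n → EReal} (hv : IsRmax v) {l : Fin n} (hl : v l ≠ ⊥) :
    ∃ r : ℝ, v l = r := ⟨(v l).toReal, (EReal.coe_toReal (hv l) hl).symm⟩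

/-- The Shapley operator of the game in which, from state `l`, the first player picks `v ∈ Vs`
with `v l ≠ ⊥` and the second player picks the next state in `O l`. -/
def shapley (O : Fin n → Set (Fin n)) (Vs : Set (Fin n → EReal)) (x : Fin n → EReal) :
    Fin n → EReal :=
  fun l => ⨅ v ∈ { v ∈ Vs | v l ≠ ⊥ }, (-(v l) + bsup (O l) v x)

lemma TIJ_eq_shapley (I J : Set (Fin n)) (Vs : Set (Fin n → EReal)) :
    TIJ I J Vs = shapley (fun l => if l ∈ I then J else I) Vs := by
  funext x l
  by_cases h : l ∈ I <;> simp [TIJ, shapley, h, bsup]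

section Shapley

variable {O : Fin n → Set (Fin n)} {Vs : Set (Fin n → EReal)}

lemma neg_add_bsup (O : Fin n → Set (Fin n)) {v : Fin n → EReal} {l : Fin n} {r : ℝ}
    (h : v l = r) (x : Fin n → EReal) :
    -(v l) + bsup (O l) v x = ((-r : ℝ) : EReal) + bsup (O l) v x := by
  rw [h, EReal.coe_neg]

lemma le_shapley_iff (hRmax : ∀ v ∈ Vs, IsRmax v) {x : Fin n → EReal} {l : Fin n} {z : EReal} :
    z ≤ shapley O Vs x l ↔ ∀ v ∈ Vs, v l ≠ ⊥ → v l + z ≤ bsup (O l) v x := by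
  unfold shapley
  rw [le_iInf₂_iff]
  refine ⟨fun h v hv hl => ?_, fun h v hv => ?_⟩
  · obtain ⟨r, hr⟩ := exists_coe_eq (hRmax v hv) hl
    have := h v ⟨hv, hl⟩
    rw [neg_add_bsup O hr] at this
    rwa [hr, coe_add_le_iff]
  · obtain ⟨r, hr⟩ := exists_coe_eq (hRmax v hv.1) hv.2
    have := h v hv.1 hv.2
    rwa [neg_add_bsup O hr, ← coe_add_le_iff, ← hr]

lemma shapley_mono : Monotone (shapley O Vs) := fun _ _ h _ =>
  iInf₂_mono fun v _ => add_le_add_right (bsup_mono v h) _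

lemma shapley_add_le (hRmax : ∀ v ∈ Vs, IsRmax v) (x : Fin n → EReal) (c : ℝ) (l : Fin n) :
    (c : EReal) + shapley O Vs x l ≤ shapley O Vs (fun i => (c : EReal) + x i) l := by
  rw [le_shapley_iff hRmax]
  intro v hv hl
  rw [bsup_add, add_left_comm]
  exact add_le_add_right ((le_shapley_iff hRmax).1 le_rfl v hv hl) _

lemma shapley_add (hRmax : ∀ v ∈ Vs, IsRmax v) (x : Fin n → EReal) (c : ℝ) (l : Fin n) :
    shapley O Vs (fun i => (c : EReal) + x i) l = (c : EReal) + shapley O Vs x l := by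
  refine le_antisymm ?_ (shapley_add_le hRmax x c l)
  rw [le_coe_add_iff]
  refine (shapley_add_le hRmax _ (-c) l).trans (le_of_eq ?_)
  simp [coe_add_coe_add, -EReal.coe_neg]

lemma exists_bsup_le_of_shapley_le (hfin : Vs.Finite) (hRmax : ∀ v ∈ Vs, IsRmax v)
    {l : Fin n} (hcover : ∃ v ∈ Vs, v l ≠ ⊥) {x : Fin n → EReal} {z : EReal}
    (h : shapley O Vs x l ≤ z) :
    ∃ v ∈ Vs, v l ≠ ⊥ ∧ bsup (O l) v x ≤ v l + z := by
  obtain ⟨v, ⟨hv, hl⟩, hmin⟩ := Set.exists_min_image { v ∈ Vs | v l ≠ ⊥ }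
    (fun v => -(v l) + bsup (O l) v x) (hfin.subset fun _ h => h.1) hcover
  refine ⟨v, hv, hl, ?_⟩
  obtain ⟨r, hr⟩ := exists_coe_eq (hRmax v hv) hl
  have h2 : -(v l) + bsup (O l) v x ≤ z := (le_iInf₂ hmin).trans h
  rw [neg_add_bsup O hr, coe_add_le_iff, neg_neg] at h2
  rwa [hr]

/-- A super-eigenvalue with a finite super-eigenvector dominates every sub-eigenvalue. -/
lemma le_of_sub_super (hRmax : ∀ v ∈ Vs, IsRmax v) {a b : ℝ} {u : Fin n → EReal}
    (hu : IsRmax u) (hu0 : u ≠ ⊥) (hsub : ∀ l, (a : EReal) + u l ≤ shapley O Vs u l)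
    {w : Fin n → ℝ} (hsup : ∀ l, shapley O Vs (ofReal w) l ≤ (b : EReal) + w l) : a ≤ b := by
  obtain ⟨l₁, hl₁⟩ : ∃ l, u l ≠ ⊥ := by
    by_contra! h
    exact hu0 (funext h)
  have : Nonempty (Fin n) := ⟨l₁⟩
  obtain ⟨l₀, hmax⟩ := Finite.exists_max fun l => ((-w l : ℝ) : EReal) + u l
  have hl₀ : u l₀ ≠ ⊥ := fun h => by
    have := hmax l₁
    rw [h, EReal.add_bot, le_bot_iff, EReal.add_eq_bot_iff] at this
    exact this.elim (EReal.coe_ne_bot _) hl₁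
  obtain ⟨r, hr⟩ := exists_coe_eq hu hl₀
  have hle : u ≤ fun l => ((r - w l₀ : ℝ) : EReal) + ofReal w l := fun l => by
    have := hmax l
    rw [hr, coe_add_le_iff, neg_neg] at this
    refine this.trans (le_of_eq ?_)
    simp only [ofReal, ← EReal.coe_add]
    congr 1
    ring
  have h := (hsub l₀).trans (shapley_mono hle l₀)
  rw [shapley_add hRmax] at h
  have h2 := h.trans (add_le_add_right (hsup l₀) _)
  rw [hr] at h2
  norm_cast at h2
  linarith

lemma exists_eigenvector (hRmax : ∀ v ∈ Vs, IsRmax v) {a : ℝ} {u : Fin n → EReal}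
    (hu : IsRmax u) (hu0 : u ≠ ⊥) (hsub : ∀ l, (a : EReal) + u l ≤ shapley O Vs u l)
    {w : Fin n → ℝ} (hsup : ∀ l, shapley O Vs (ofReal w) l ≤ (a : EReal) + w l) :
    ∃ z, IsRmax z ∧ z ≠ ⊥ ∧ shapley O Vs z = fun l => (a : EReal) + z l := by
  obtain ⟨c, hc⟩ : ∃ c : ℝ, ∀ l, u l ≤ (c : EReal) + w l := by
    obtain ⟨c, hc⟩ := (Set.finite_range fun l => (u l).toReal - w l).bddAbove
    refine ⟨c, fun l => (EReal.le_coe_toReal (hu l)).trans ?_⟩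
    have := hc ⟨l, rfl⟩
    norm_cast
    linarith
  let F : (Fin n → EReal) → Fin n → EReal := fun x l => ((-a : ℝ) : EReal) + shapley O Vs x l
  have hF : Monotone F := fun x y h l => add_le_add_right (shapley_mono h l) _
  let W : Fin n → EReal := fun l => (c : EReal) + ofReal w l
  have hW : F W ≤ W := fun l => by
    change ((-a : ℝ) : EReal) + shapley O Vs (fun l => (c : EReal) + ofReal w l) l ≤ _
    rw [shapley_add hRmax, coe_add_le_iff, neg_neg, add_left_comm]
    exact add_le_add_right (hsup l) _
  let A : Set (Fin n → EReal) := { x | x ≤ W ∧ x ≤ F x }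
  have huA : u ∈ A := ⟨hc, fun l => (coe_add_le_iff _ _ _).1 (hsub l)⟩
  have hzW : sSup A ≤ W := sSup_le fun x hx => hx.1
  have hzF : sSup A ≤ F (sSup A) := sSup_le fun x hx => hx.2.trans (hF (le_sSup hx))
  have hFz : F (sSup A) ≤ sSup A := le_sSup ⟨(hF hzW).trans hW, hF hzF⟩
  refine ⟨sSup A, fun l => ?_, fun h => hu0 ?_, funext fun l => le_antisymm ?_ ?_⟩
  · exact ((hzW l).trans_lt (by simp [W, ofReal, ← EReal.coe_add, EReal.coe_lt_top])).ne
  · exact le_bot_iff.1 ((le_sSup huA).trans h.le)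
  · have := hFz l
    rwa [coe_add_le_iff, neg_neg] at this
  · rw [coe_add_le_iff]
    exact hzF l

end Shapley

section AdditiveEigenvector

lemma lipschitzWith_one_of_monotone_of_homogeneous {G : (Fin n → ℝ) → Fin n → ℝ}
    (hmono : Monotone G) (hadd : ∀ x (c : ℝ), G (fun i => c + x i) = fun i => c + G x i) :
    LipschitzWith 1 G := by
  have key : ∀ x y l, G x l ≤ dist x y + G y l := fun x y l => by
    have h : x ≤ fun i => dist x y + y i := fun i => by
      have := (le_abs_self _).trans ((Real.dist_eq _ _).symm.le.trans (dist_le_pi_dist x y i))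
      linarith
    simpa only [hadd] using hmono h l
  refine LipschitzWith.of_dist_le_mul fun x y => ?_
  rw [NNReal.coe_one, one_mul, dist_pi_le_iff dist_nonneg]
  intro l
  rw [Real.dist_eq, abs_le]
  have h₁ := key x y l
  have h₂ := key y x l
  rw [dist_comm] at h₂
  constructor <;> linarith

/-- A monotone additively homogeneous self-map of `ℝⁿ` whose image is bounded in Hilbert's
seminorm has an additive eigenvector; it is obtained as a limit of normalized fixed points of the
discounted maps `x ↦ G (α x)`. -/
lemma exists_additive_eigenvector [Nonempty (Fin n)] {G : (Fin n → ℝ) → Fin n → ℝ}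
    (hmono : Monotone G) (hadd : ∀ x (c : ℝ), G (fun i => c + x i) = fun i => c + G x i)
    {R : ℝ} (hR : ∀ x i j, G x i - G x j ≤ R) :
    ∃ (u : Fin n → ℝ) (a : ℝ), ∀ l, G u l = a + u l := by
  have hlip := lipschitzWith_one_of_monotone_of_homogeneous hmono hadd
  obtain ⟨i₀⟩ := ‹Nonempty (Fin n)›
  have hdisc : ∀ α : ℝ, 0 ≤ α → α < 1 → ∃ y ∈ Set.Icc (fun _ : Fin n => -R) (fun _ => R),
      ∀ l, G (α • y) l - G (α • y) i₀ = y l := by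
    intro α h0 h1
    have hc : ContractingWith ‖α‖₊ fun x : Fin n → ℝ => G (α • x) := by
      refine ⟨?_, ?_⟩
      · rw [← NNReal.coe_lt_coe, coe_nnnorm, Real.norm_eq_abs, abs_of_nonneg h0]
        exact h1
      · have h := hlip.comp (lipschitzWith_smul (β := Fin n → ℝ) α)
        rw [one_mul] at h
        exact h
    obtain ⟨x, hx⟩ : ∃ x, G (α • x) = x := ⟨_, hc.fixedPoint_isFixedPt⟩
    have hy : G (α • fun i => x i - x i₀) = fun i => -(α * x i₀) + x i := by
      conv_rhs => rw [← hx, ← hadd, hx]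
      congr 1
      funext i
      simp only [Pi.smul_apply, smul_eq_mul]
      ring
    refine ⟨fun i => x i - x i₀, ⟨fun i => ?_, fun i => ?_⟩, fun l => ?_⟩
    · have := hR (α • x) i₀ i
      rw [hx] at this
      linarith
    · have := hR (α • x) i i₀
      rwa [hx] at this
    · rw [hy]
      ring
  have h0 : ∀ k : ℕ, (0 : ℝ) ≤ 1 - 1 / ((k : ℝ) + 1) := fun k => by
    rw [sub_nonneg, div_le_one (by positivity)]
    linarith [k.cast_nonneg (α := ℝ)]
  have h1 : ∀ k : ℕ, 1 - 1 / ((k : ℝ) + 1) < 1 := fun k => sub_lt_self _ (by positivity)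
  choose y hy hyG using fun k : ℕ => hdisc _ (h0 k) (h1 k)
  obtain ⟨u, -, φ, hφ, hlim⟩ := isCompact_Icc.tendsto_subseq hy
  have hα : Filter.Tendsto (fun k : ℕ => 1 - 1 / ((k : ℝ) + 1)) Filter.atTop (nhds 1) := by
    simpa using (tendsto_const_nhds (x := (1 : ℝ))).sub
      (tendsto_one_div_add_atTop_nhds_zero_nat (𝕜 := ℝ))
  have hG : Filter.Tendsto (fun k => G ((1 - 1 / ((φ k : ℝ) + 1)) • y (φ k))) Filter.atTop
      (nhds (G u)) := by
    have h := (hα.comp hφ.tendsto_atTop).smul hlim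
    rw [one_smul] at h
    exact (hlip.continuous.tendsto u).comp h
  refine ⟨u, G u i₀, fun l => ?_⟩
  have hGl := (tendsto_pi_nhds.1 hG l).sub (tendsto_pi_nhds.1 hG i₀)
  have hul := tendsto_pi_nhds.1 hlim l
  simp only [Function.comp_apply, hyG] at hGl hul
  linarith [tendsto_nhds_unique hGl hul]

end AdditiveEigenvector

section Perturbation

variable {O : Fin n → Set (Fin n)} {Vs : Set (Fin n → EReal)}

lemma exists_entry_bound (hfin : Vs.Finite) (hRmax : ∀ v ∈ Vs, IsRmax v) :
    ∃ C : ℝ, 0 ≤ C ∧ ∀ v ∈ Vs, ∀ l j, v l ≠ ⊥ → v j ≤ (C : EReal) + v l := by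
  obtain ⟨C, hC⟩ := ((hfin.prod (Set.finite_univ (α := Fin n × Fin n))).image
    fun p => (p.1 p.2.2).toReal - (p.1 p.2.1).toReal).bddAbove
  refine ⟨max C 0, le_max_right _ _, fun v hv l j hl => ?_⟩
  obtain ⟨r, hr⟩ := exists_coe_eq (hRmax v hv) hl
  refine (EReal.le_coe_toReal (hRmax v hv j)).trans ?_
  have := hC ⟨(v, l, j), ⟨hv, trivial⟩, rfl⟩
  simp only [hr, EReal.toReal_coe] at this
  rw [hr]
  norm_cast
  linarith [le_max_left C 0]

/-- The Shapley operator in which the second player may moreover jump anywhere at cost `K`. -/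
def jumpShapley (O : Fin n → Set (Fin n)) (Vs : Set (Fin n → EReal)) (K : ℝ)
    (x : Fin n → EReal) : Fin n → EReal :=
  fun l => shapley O Vs x l ⊔ (((-K : ℝ) : EReal) + ⨆ k, x k)

lemma jumpShapley_mono (K : ℝ) : Monotone (jumpShapley O Vs K) := fun _ _ h l =>
  sup_le_sup (shapley_mono h l) (add_le_add_right (iSup_mono h) _)

lemma iSup_eq_bsup_univ (x : Fin n → EReal) : ⨆ k, x k = bsup Set.univ 0 x := by
  simp [bsup]

lemma jumpShapley_add (hRmax : ∀ v ∈ Vs, IsRmax v) (K : ℝ) (x : Fin n → EReal) (c : ℝ)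
    (l : Fin n) : jumpShapley O Vs K (fun i => (c : EReal) + x i) l
      = (c : EReal) + jumpShapley O Vs K x l := by
  have hmono : Monotone fun a : EReal => (c : EReal) + a := fun _ _ h => add_le_add_right h _
  rw [jumpShapley, jumpShapley, shapley_add hRmax, iSup_eq_bsup_univ, bsup_add,
    ← iSup_eq_bsup_univ, add_left_comm, ← hmono.map_sup]

/-- The restriction of `jumpShapley` to finite vectors. -/
def realJumpShapley (O : Fin n → Set (Fin n)) (Vs : Set (Fin n → EReal)) (K : ℝ)
    (x : Fin n → ℝ) : Fin n → ℝ := fun l => (jumpShapley O Vs K (ofReal x) l).toReal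

lemma shapley_le_of_entry_bound (hRmax : ∀ v ∈ Vs, IsRmax v) {l : Fin n}
    (hcover : ∃ v ∈ Vs, v l ≠ ⊥) {C : ℝ}
    (hC : ∀ v ∈ Vs, ∀ l j, v l ≠ ⊥ → v j ≤ (C : EReal) + v l) (x : Fin n → EReal) :
    shapley O Vs x l ≤ (C : EReal) + ⨆ k, x k := by
  obtain ⟨v, hv, hl⟩ := hcover
  refine (iInf₂_le v ⟨hv, hl⟩).trans ?_
  obtain ⟨r, hr⟩ := exists_coe_eq (hRmax v hv) hl
  rw [neg_add_bsup O hr, coe_add_le_iff, neg_neg]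
  refine bsup_le_iff.2 fun j _ => ?_
  refine (add_le_add (hC v hv l j hl) (le_iSup x j)).trans (le_of_eq ?_)
  rw [hr, add_comm (C : EReal), add_assoc]

lemma exists_iSup_ofReal [Nonempty (Fin n)] (x : Fin n → ℝ) :
    ∃ i, (⨆ k, ofReal x k) = x i ∧ ∀ k, x k ≤ x i := by
  obtain ⟨i, hi⟩ := Finite.exists_max x
  refine ⟨i, le_antisymm (iSup_le fun k => ?_) (le_iSup (ofReal x) i), hi⟩
  exact EReal.coe_le_coe_iff.2 (hi k)

lemma coe_realJumpShapley [Nonempty (Fin n)] (hRmax : ∀ v ∈ Vs, IsRmax v)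
    (hcover : ∀ l : Fin n, ∃ v ∈ Vs, v l ≠ ⊥) {C : ℝ}
    (hC : ∀ v ∈ Vs, ∀ l j, v l ≠ ⊥ → v j ≤ (C : EReal) + v l) (K : ℝ) (x : Fin n → ℝ)
    (l : Fin n) : (realJumpShapley O Vs K x l : EReal) = jumpShapley O Vs K (ofReal x) l := by
  obtain ⟨i, hi, -⟩ := exists_iSup_ofReal x
  refine EReal.coe_toReal (ne_of_lt ?_) (ne_of_gt ?_)
  · refine sup_lt_iff.2 ⟨(shapley_le_of_entry_bound hRmax (hcover l) hC _).trans_lt ?_, ?_⟩ <;>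
    · rw [hi]
      norm_cast
      exact EReal.coe_lt_top _
  · refine lt_of_lt_of_le ?_ le_sup_right
    rw [hi]
    norm_cast
    exact EReal.bot_lt_coe _

lemma exists_realJumpShapley_eigenvector [Nonempty (Fin n)] (hRmax : ∀ v ∈ Vs, IsRmax v)
    (hcover : ∀ l : Fin n, ∃ v ∈ Vs, v l ≠ ⊥) {C : ℝ}
    (hC : ∀ v ∈ Vs, ∀ l j, v l ≠ ⊥ → v j ≤ (C : EReal) + v l) {K : ℝ} (hCK : 0 ≤ C + K) :
    ∃ (u : Fin n → ℝ) (a : ℝ), ∀ l, jumpShapley O Vs K (ofReal u) l = (a : EReal) + u l := by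
  have hcoe := coe_realJumpShapley (O := O) hRmax hcover hC K
  obtain ⟨u, a, h⟩ := exists_additive_eigenvector (G := realJumpShapley O Vs K) (R := C + K)
    (fun x y hxy l => by
      rw [← EReal.coe_le_coe_iff, hcoe, hcoe]
      exact jumpShapley_mono K (fun i => EReal.coe_le_coe_iff.2 (hxy i)) l)
    (fun x c => funext fun l => by
      rw [← EReal.coe_eq_coe_iff, EReal.coe_add, hcoe, hcoe, ← jumpShapley_add hRmax]
      rfl)
    (fun x i j => by
      obtain ⟨m, hm, -⟩ := exists_iSup_ofReal x
      have hj : ((-K + x m : ℝ) : EReal) ≤ realJumpShapley O Vs K x j := by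
        rw [hcoe, EReal.coe_add, ← hm]
        exact le_sup_right
      have hi : (realJumpShapley O Vs K x i : EReal) ≤ ((C + x m : ℝ) : EReal) := by
        rw [hcoe]
        refine sup_le ((shapley_le_of_entry_bound hRmax (hcover i) hC _).trans ?_) ?_
        · rw [hm, EReal.coe_add]
        · rw [hm, ← EReal.coe_add, EReal.coe_le_coe_iff]
          linarith
      rw [EReal.coe_le_coe_iff] at hi hj
      linarith)
  exact ⟨u, a, fun l => by rw [← hcoe, h, EReal.coe_add]⟩

lemma exists_gap (u : Fin n → ℝ) (i : Fin n) (hi : ∀ k, u k ≤ u i) {D : ℝ} (hD : 0 < D) :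
    ∃ t : ℝ, t < u i ∧ u i - n * D ≤ t ∧ ∀ k, t < u k ∨ u k ≤ t - D := by
  obtain ⟨N, hN, hN'⟩ : ∃ N ∈ Finset.range (n + 1),
      N ∉ Finset.univ.image fun k => ⌊(u i - u k) / D⌋₊ := by
    refine Finset.exists_mem_notMem_of_card_lt_card (lt_of_le_of_lt Finset.card_image_le ?_)
    simp
  have hNk : ∀ k, ⌊(u i - u k) / D⌋₊ ≠ N := fun k h =>
    hN' (Finset.mem_image.2 ⟨k, Finset.mem_univ k, h⟩)
  have hpos : 0 < (N : ℝ) := by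
    have := hNk i
    simp only [sub_self, zero_div, Nat.floor_zero] at this
    exact_mod_cast Nat.pos_of_ne_zero this.symm
  have hNn : (N : ℝ) ≤ n := by exact_mod_cast Nat.lt_succ_iff.1 (Finset.mem_range.1 hN)
  refine ⟨u i - N * D, by nlinarith, by nlinarith, fun k => ?_⟩
  rcases lt_or_gt_of_ne (hNk k) with h | h
  · left
    have := (Nat.floor_lt (div_nonneg (sub_nonneg.2 (hi k)) hD.le)).1 h
    rw [div_lt_iff₀ hD] at this
    linarith
  · right
    have := (Nat.le_floor_iff (div_nonneg (sub_nonneg.2 (hi k)) hD.le)).1 (Nat.succ_le_of_lt h)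
    rw [le_div_iff₀ hD] at this
    push_cast at this
    linarith

/-- When the jump cost is large, truncating an eigenvector of the perturbed operator at a gap
between its coordinates gives a sub-eigenvector of the Shapley operator. -/
lemma exists_sub_eigenvector [Nonempty (Fin n)] (hRmax : ∀ v ∈ Vs, IsRmax v) {C : ℝ}
    (hC0 : 0 ≤ C) (hC : ∀ v ∈ Vs, ∀ l j, v l ≠ ⊥ → v j ≤ (C : EReal) + v l) {M K a : ℝ}
    (hM : 0 ≤ M) (ha : -M ≤ a) (hK : n * (C + M + 1) + M ≤ K) {u : Fin n → ℝ}
    (hu : ∀ l, jumpShapley O Vs K (ofReal u) l = (a : EReal) + u l) :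
    ∃ z, IsRmax z ∧ z ≠ ⊥ ∧ ∀ l, (a : EReal) + z l ≤ shapley O Vs z l := by
  obtain ⟨i, hi, hmax⟩ := exists_iSup_ofReal u
  obtain ⟨t, hti, hnt, hgap⟩ := exists_gap u i hmax (D := C + M + 1) (by linarith)
  refine ⟨fun l => if t < u l then (u l : EReal) else ⊥, fun l => ?_, fun h => ?_, fun l => ?_⟩
  · dsimp only
    split_ifs <;> simp
  · have := congrFun h i
    simp [hti] at this
  dsimp only
  split_ifs with hl
  swap
  · simp
  have hsh : (a : EReal) + u l ≤ shapley O Vs (ofReal u) l := by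
    have h := hu l
    rw [jumpShapley, hi] at h
    rcases le_sup_iff.1 h.ge with h' | h'
    · exact h'
    · norm_cast at h'
      linarith
  rw [le_shapley_iff hRmax] at hsh ⊢
  intro v hv hvl
  obtain ⟨r, hr⟩ := exists_coe_eq (hRmax v hv) hvl
  have hle : bsup (O l) v (ofReal u) ≤
      bsup (O l) v (fun l => if t < u l then (u l : EReal) else ⊥) ⊔
        ((C + r + (t - (C + M + 1)) : ℝ) : EReal) := by
    refine bsup_le_iff.2 fun j hj => ?_
    rcases hgap j with h | h
    · refine le_sup_of_le_left (le_trans (le_of_eq ?_) (le_bsup _ _ hj))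
      simp [h, ofReal]
    · refine le_sup_of_le_right ?_
      rw [EReal.coe_add, EReal.coe_add, ← hr]
      exact add_le_add (hC v hv l j hvl) (EReal.coe_le_coe_iff.2 h)
  rcases le_sup_iff.1 ((hsh v hv hvl).trans hle) with h | h
  · exact h
  · rw [hr] at h
    norm_cast at h
    linarith

/-- Either every real number is a super-eigenvalue, or some real number is both a sub-eigenvalue
and a super-eigenvalue. -/
lemma shapley_dichotomy [Nonempty (Fin n)] (hfin : Vs.Finite) (hRmax : ∀ v ∈ Vs, IsRmax v)
    (hcover : ∀ l : Fin n, ∃ v ∈ Vs, v l ≠ ⊥) :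
    (∀ b : ℝ, ∃ w : Fin n → ℝ, ∀ l, shapley O Vs (ofReal w) l ≤ (b : EReal) + w l) ∨
    ∃ a : ℝ, (∃ z, IsRmax z ∧ z ≠ ⊥ ∧ ∀ l, (a : EReal) + z l ≤ shapley O Vs z l) ∧
      ∃ w : Fin n → ℝ, ∀ l, shapley O Vs (ofReal w) l ≤ (a : EReal) + w l := by
  obtain ⟨C, hC0, hC⟩ := exists_entry_bound hfin hRmax
  by_contra! hcon
  obtain ⟨⟨b, hb⟩, hcon⟩ := hcon
  set M : ℝ := max (-b) 0 with hMdef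
  have hM : 0 ≤ M := le_max_right _ _
  have hK : 0 ≤ n * (C + M + 1) + M := by positivity
  obtain ⟨u, a, hu⟩ := exists_realJumpShapley_eigenvector (O := O) hRmax hcover hC
    (K := n * (C + M + 1) + M) (by linarith)
  have hsuper : ∀ l, shapley O Vs (ofReal u) l ≤ (a : EReal) + u l := fun l =>
    le_sup_left.trans (hu l).le
  rcases le_or_gt (-M) a with ha | ha
  · obtain ⟨z, hz, hz0, hsub⟩ := exists_sub_eigenvector hRmax hC0 hC hM ha le_rfl hu
    obtain ⟨l, hl⟩ := hcon a ⟨z, hz, hz0, hsub⟩ u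
    exact hl.not_ge (hsuper l)
  · obtain ⟨l, hl⟩ := hb u
    refine hl.not_ge ((hsuper l).trans (add_le_add_left (EReal.coe_le_coe_iff.2 ?_) _))
    linarith [le_max_left (-b) 0]

end Perturbation

section SpectralRadius

variable [Nonempty (Fin n)] {O : Fin n → Set (Fin n)} {Vs : Set (Fin n → EReal)}

lemma rhoOp_shapley_cases (hfin : Vs.Finite) (hRmax : ∀ v ∈ Vs, IsRmax v)
    (hcover : ∀ l : Fin n, ∃ v ∈ Vs, v l ≠ ⊥) :
    (rhoOp (shapley O Vs) = ⊥ ∧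
      ∀ b : ℝ, ∃ w : Fin n → ℝ, ∀ l, shapley O Vs (ofReal w) l ≤ (b : EReal) + w l) ∨
    ∃ a : ℝ, rhoOp (shapley O Vs) = a ∧
      (∃ z, IsRmax z ∧ z ≠ ⊥ ∧ ∀ l, (a : EReal) + z l ≤ shapley O Vs z l) ∧
      ∃ w : Fin n → ℝ, ∀ l, shapley O Vs (ofReal w) l ≤ (a : EReal) + w l := by
  have hle : ∀ (b : ℝ) (w : Fin n → ℝ),
      (∀ l, shapley O Vs (ofReal w) l ≤ (b : EReal) + w l) → rhoOp (shapley O Vs) ≤ b := by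
    rintro b w hw
    refine sSup_le ?_
    rintro c ⟨hc, u, hu, hu0, h⟩
    induction c with
    | bot => exact bot_le
    | top => exact (hc rfl).elim
    | coe c => exact EReal.coe_le_coe_iff.2 (le_of_sub_super hRmax hu hu0 (fun l => by rw [h]) hw)
  rcases shapley_dichotomy (O := O) hfin hRmax hcover with h | ⟨a, ⟨z, hz, hz0, hsub⟩, w, hw⟩
  · refine Or.inl ⟨?_, h⟩
    rw [EReal.eq_bot_iff_forall_lt]
    intro b
    obtain ⟨w, hw⟩ := h (b - 1)
    exact (hle _ w hw).trans_lt (EReal.coe_lt_coe_iff.2 (by linarith))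
  · refine Or.inr ⟨a, le_antisymm (hle a w hw) (le_sSup ?_), ⟨z, hz, hz0, hsub⟩, w, hw⟩
    obtain ⟨u, hu, hu0, h⟩ := exists_eigenvector hRmax hz hz0 hsub hw
    exact ⟨EReal.coe_ne_top a, u, hu, hu0, h⟩

lemma le_rhoOp_shapley (hfin : Vs.Finite) (hRmax : ∀ v ∈ Vs, IsRmax v)
    (hcover : ∀ l : Fin n, ∃ v ∈ Vs, v l ≠ ⊥) {a : ℝ} {z : Fin n → EReal} (hz : IsRmax z)
    (hz0 : z ≠ ⊥) (hsub : ∀ l, (a : EReal) + z l ≤ shapley O Vs z l) :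
    (a : EReal) ≤ rhoOp (shapley O Vs) := by
  rcases rhoOp_shapley_cases (O := O) hfin hRmax hcover with ⟨-, h⟩ | ⟨c, hc, -, w, hw⟩
  · obtain ⟨w, hw⟩ := h (a - 1)
    linarith [le_of_sub_super hRmax hz hz0 hsub hw]
  · rw [hc]
    exact EReal.coe_le_coe_iff.2 (le_of_sub_super hRmax hz hz0 hsub hw)

end SpectralRadius

section Hilbert

lemma coe_add_le_self {r : ℝ} (hr : r ≤ 0) (a : EReal) : (r : EReal) + a ≤ a := by
  simpa using add_le_add_left (EReal.coe_le_coe_iff.2 hr) a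

lemma hd_le {x y : Fin n → EReal} {lam mu : ℝ} (h : mu ≤ lam)
    (h₁ : ∀ i, (mu : EReal) + y i ≤ x i) (h₂ : ∀ i, x i ≤ (lam : EReal) + y i) :
    hd x y ≤ ((lam - mu : ℝ) : EReal) := by
  unfold hd
  split_ifs
  · exact_mod_cast sub_nonneg.2 h
  · exact sInf_le ⟨lam, mu, EReal.coe_sub _ _, h₁, h₂⟩

lemma bsup_congr_left {S : Set (Fin n)} {v w : Fin n → EReal} (x : Fin n → EReal)
    (h : ∀ j ∈ S, v j = w j) : bsup S v x = bsup S w x :=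
  iSup_congr fun j => iSup_congr fun hj => by rw [h j hj]

lemma bsup_add_left (S : Set (Fin n)) (v x : Fin n → EReal) (c : ℝ) :
    bsup S (fun i => (c : EReal) + v i) x = (c : EReal) + bsup S v x := by
  rw [bsup_comm, bsup_add, bsup_comm]

lemma bsup_bot_left (S : Set (Fin n)) (x : Fin n → EReal) : bsup S ⊥ x = ⊥ := by
  simp [bsup]

lemma mem_shyper_iff {I J : Set (Fin n)} {b x : Fin n → EReal} :
    x ∈ shyper I J b ↔ IsRmax x ∧ bsup I x b = bsup J x b := by
  rw [bsup_comm I, bsup_comm J]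
  rfl

lemma add_bsup_le_of_hd_lt {P Q : Set (Fin n)} {v x b : Fin n → EReal} {t : ℝ}
    (hx : bsup P x b = bsup Q x b) (h : hd v x < t) :
    ((-t : ℝ) : EReal) + bsup P v b ≤ bsup Q v b := by
  unfold hd at h
  split_ifs at h with h0
  · rw [h0.1, bsup_bot_left]
    simp
  obtain ⟨_, ⟨lam, mu, rfl, h₁, h₂⟩, hlt⟩ := sInf_lt_iff.1 h
  norm_cast at hlt
  have hP : bsup P v b ≤ (lam : EReal) + bsup Q x b := by
    rw [← hx, ← bsup_add_left, bsup_comm, bsup_comm P _ b]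
    exact bsup_mono b h₂
  have hQ : (mu : EReal) + bsup Q x b ≤ bsup Q v b := by
    rw [← bsup_add_left, bsup_comm, bsup_comm Q v]
    exact bsup_mono b h₁
  refine (add_le_add_right hP _).trans (le_trans ?_ hQ)
  rw [coe_add_coe_add]
  exact add_le_add_left (EReal.coe_le_coe_iff.2 (by linarith)) _

lemma distPt_shyper_le {I J : Set (Fin n)} (hdisj : Disjoint I J) {v b : Fin n → EReal}
    (hv : IsRmax v) (hb : IsRmax b) {a : ℝ} (ha : a ≤ 0)
    (hIJ : (a : EReal) + bsup I v b ≤ bsup J v b) (hJI : (a : EReal) + bsup J v b ≤ bsup I v b) :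
    distPt v (shyper I J b) ≤ ((-a : ℝ) : EReal) := by
  obtain ⟨t, hat, hta, ht⟩ :
      ∃ t : ℝ, a ≤ t ∧ t ≤ -a ∧ (t : EReal) + bsup I v b = bsup J v b := by
    have hI := bsup_ne_top (S := I) hv hb
    have hJ := bsup_ne_top (S := J) hv hb
    generalize bsup I v b = A at *
    generalize bsup J v b = B at *
    induction A with
    | top => exact (hI rfl).elim
    | bot =>
      rw [le_bot_iff, EReal.add_eq_bot_iff] at hJI
      exact ⟨0, ha, by linarith, by simp [hJI.resolve_left (EReal.coe_ne_bot _)]⟩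
    | coe A =>
      induction B with
      | top => exact (hJ rfl).elim
      | bot =>
        rw [le_bot_iff, EReal.add_eq_bot_iff] at hIJ
        exact (hIJ.elim (EReal.coe_ne_bot _) (EReal.coe_ne_bot _)).elim
      | coe B =>
        norm_cast at hIJ hJI
        refine ⟨B - A, by linarith, by linarith, ?_⟩
        norm_cast
        ring
  let x : Fin n → EReal := fun i => if i ∈ I then (t : EReal) + v i else v i
  have hx : x ∈ shyper I J b := by
    refine mem_shyper_iff.2 ⟨fun i => ?_, ?_⟩
    · by_cases hi : i ∈ I
      · simpa [x, hi] using (EReal.add_lt_top (EReal.coe_ne_top t) (hv i)).ne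
      · simpa [x, hi] using hv i
    · rw [bsup_congr_left (w := fun i => (t : EReal) + v i) b fun j hj => if_pos hj,
        bsup_congr_left (S := J) (w := v) b
          fun j hj => if_neg fun h => Set.disjoint_left.1 hdisj h hj,
        bsup_add_left, ht]
  refine (iInf₂_le x hx).trans ((hd_le (lam := max (-t) 0) (mu := min (-t) 0)
    min_le_max (fun i => ?_) (fun i => ?_)).trans (EReal.coe_le_coe_iff.2 ?_))
  · by_cases hi : i ∈ I
    · simp only [x, hi, if_true, coe_add_coe_add]
      exact coe_add_le_self (by linarith [min_le_left (-t) 0]) _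
    · simp only [x, hi, if_false]
      exact coe_add_le_self (min_le_right _ _) _
  · rw [le_coe_add_iff]
    by_cases hi : i ∈ I
    · simp only [x, hi, if_true]
      rw [le_coe_add_iff, coe_add_coe_add]
      exact coe_add_le_self (by linarith [le_max_left (-t) 0]) _
    · simp only [x, hi, if_false]
      exact coe_add_le_self (by linarith [le_max_right (-t) 0]) _
  · rcases le_total (-t) 0 with h | h <;> simp [h] <;> linarith

end Hilbert

section Span

lemma isTropCone_span (Vs : Set (Fin n → EReal)) : IsTropCone (span Vs) :=
  ⟨fun x hx y hy C hC => hC.1.1 x (hx C hC) y (hy C hC),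
    fun x hx lam hlam C hC => hC.1.2 x (hx C hC) lam hlam⟩

lemma subset_span (Vs : Set (Fin n → EReal)) : Vs ⊆ span Vs := fun _ hx _ hC => hC.2 hx

lemma isTropCone_halfspace (P Q : Set (Fin n)) (b : Fin n → EReal) (a : ℝ) :
    IsTropCone { y : Fin n → EReal | (a : EReal) + bsup P y b ≤ bsup Q y b } := by
  have hmono : ∀ (S : Set (Fin n)) {y z : Fin n → EReal}, y ≤ z → bsup S y b ≤ bsup S z b :=
    fun S y z h => by
      rw [bsup_comm, bsup_comm S z]
      exact bsup_mono b h
  refine ⟨fun y hy z hz => ?_, fun y hy c hc => ?_⟩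
  · rw [Set.mem_ofPred_eq, coe_add_le_iff] at *
    refine bsup_le_iff.2 fun j hj => ?_
    rcases le_total (y j) (z j) with h | h
    · rw [sup_of_le_right h]
      exact (le_bsup z b hj).trans (hz.trans (add_le_add_right (hmono Q fun i => le_sup_right) _))
    · rw [sup_of_le_left h]
      exact (le_bsup y b hj).trans (hy.trans (add_le_add_right (hmono Q fun i => le_sup_left) _))
  · induction c with
    | top => exact (hc rfl).elim
    | bot =>
      have : (fun i => ⊥ + y i) = (⊥ : Fin n → EReal) := funext fun i => EReal.bot_add _
      rw [Set.mem_ofPred_eq, this, bsup_bot_left]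
      simp
    | coe c =>
      rw [Set.mem_ofPred_eq, bsup_add_left, bsup_add_left, add_left_comm]
      exact add_le_add_right hy _

lemma add_bsup_le_of_mem_span {P Q : Set (Fin n)} {b : Fin n → EReal} {a : ℝ}
    {Vs : Set (Fin n → EReal)} (h : ∀ v ∈ Vs, (a : EReal) + bsup P v b ≤ bsup Q v b)
    {y : Fin n → EReal} (hy : y ∈ span Vs) : (a : EReal) + bsup P y b ≤ bsup Q y b :=
  hy _ ⟨isTropCone_halfspace P Q b a, h⟩

lemma le_neg_of_vinterval_subset_span {I J : Set (Fin n)} (hdisj : Disjoint I J)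
    (hunion : I ∪ J = Set.univ) {Vs : Set (Fin n → EReal)} {b : Fin n → EReal} (hb : IsRmax b)
    (hb0 : b ≠ ⊥) {a : ℝ} (hIJ : ∀ v ∈ Vs, (a : EReal) + bsup I v b ≤ bsup J v b)
    (hJI : ∀ v ∈ Vs, (a : EReal) + bsup J v b ≤ bsup I v b) {r : ℝ} (hr : 0 ≤ r)
    {w : Fin n → ℝ} (hw : vinterval J w r ⊆ span Vs) : a ≤ -r := by
  let y : ℝ → Fin n → EReal := fun m => ofReal fun l => 0 + w l + if l ∈ J then m else 0
  have hy : ∀ m, -r ≤ m → m ≤ r → y m ∈ span Vs := fun m h₁ h₂ =>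
    hw ⟨0, m, by exact_mod_cast h₁, by exact_mod_cast h₂, rfl⟩
  have hyI : ∀ m, bsup I (y m) b = bsup I (ofReal w) b := fun m =>
    bsup_congr_left b fun j hj => by simp [y, ofReal, Set.disjoint_left.1 hdisj hj]
  have hyJ : ∀ m, bsup J (y m) b = (m : EReal) + bsup J (ofReal w) b := fun m => by
    rw [← bsup_add_left]
    exact bsup_congr_left b fun j hj => by simp [y, ofReal, hj, add_comm]
  have h₁ := add_bsup_le_of_mem_span hIJ (hy (-r) le_rfl (by linarith))
  have h₂ := add_bsup_le_of_mem_span hJI (hy r (by linarith) le_rfl)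
  rw [hyI, hyJ] at h₁ h₂
  have hwR : IsRmax (ofReal w) := fun i => EReal.coe_ne_top _
  have hA := bsup_ne_top (S := I) hwR hb
  have hB := bsup_ne_top (S := J) hwR hb
  have hAB : ¬ (bsup I (ofReal w) b = ⊥ ∧ bsup J (ofReal w) b = ⊥) := by
    rintro ⟨hA0, hB0⟩
    refine hb0 (funext fun l => ?_)
    have hl : ofReal w l + b l ≤ ⊥ := by
      rcases (hunion.symm ▸ Set.mem_univ l : l ∈ I ∪ J) with h | h
      · exact (le_bsup _ _ h).trans hA0.le
      · exact (le_bsup _ _ h).trans hB0.le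
    exact (EReal.add_eq_bot_iff.1 (le_bot_iff.1 hl)).resolve_left (EReal.coe_ne_bot _)
  generalize bsup I (ofReal w) b = A at *
  generalize bsup J (ofReal w) b = B at *
  induction A <;> induction B <;> simp_all [-EReal.coe_neg]
  all_goals norm_cast at h₁ h₂
  linarith

lemma exists_mem_span_separating {P Q : Set (Fin n)} (hP : P.Nonempty)
    {Vs : Set (Fin n → EReal)} (hRmax : ∀ v ∈ Vs, IsRmax v) {w : Fin n → ℝ} {a : ℝ}
    (h : ∀ l ∈ P, ∃ v ∈ Vs, v l ≠ ⊥ ∧ bsup Q v (ofReal w) ≤ v l + ((a : EReal) + w l)) :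
    ∃ g ∈ span Vs, IsRmax g ∧ (∀ l ∈ P, ((-w l : ℝ) : EReal) ≤ g l) ∧
      ∀ l ∈ Q, g l ≤ ((a - w l : ℝ) : EReal) := by
  choose! v hv hvl hvQ using h
  let f : Fin n → Fin n → EReal := fun l k => ((-(v l l).toReal - w l : ℝ) : EReal) + v l k
  have hne : (Finset.univ.filter (· ∈ P)).Nonempty :=
    hP.imp fun l hl => by simpa using hl
  have hmem : ∀ {l}, l ∈ Finset.univ.filter (· ∈ P) → l ∈ P := fun h => by simpa using h
  refine ⟨(Finset.univ.filter (· ∈ P)).sup' hne f, ?_, fun k => ?_, fun l hl => ?_, fun k hk => ?_⟩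
  · refine Finset.sup'_induction hne f (p := (· ∈ span Vs))
      (fun x hx y hy => (isTropCone_span Vs).1 x hx y hy) fun l hl => ?_
    exact (isTropCone_span Vs).2 _ (subset_span Vs (hv l (hmem hl))) _ (EReal.coe_ne_top _)
  · rw [Finset.sup'_apply]
    refine ((Finset.sup'_lt_iff hne).2 fun l hl => ?_).ne
    exact EReal.add_lt_top (EReal.coe_ne_top _) (hRmax _ (hv l (hmem hl)) k)
  · rw [Finset.sup'_apply]
    refine le_trans ?_ (Finset.le_sup' (fun l' => f l' l) (by simpa using hl))
    obtain ⟨r, hr⟩ := exists_coe_eq (hRmax _ (hv l hl)) (hvl l hl)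
    simp only [f, hr, EReal.toReal_coe]
    norm_cast
    linarith
  · rw [Finset.sup'_apply]
    refine Finset.sup'_le hne _ fun l hl => ?_
    obtain ⟨r, hr⟩ := exists_coe_eq (hRmax _ (hv l (hmem hl))) (hvl l (hmem hl))
    have hk' := (le_bsup (v l) (ofReal w) hk).trans (hvQ l (hmem hl))
    simp only [f, hr, EReal.toReal_coe]
    rw [hr, ofReal, add_comm, coe_add_le_iff] at hk'
    rw [coe_add_le_iff]
    refine hk'.trans ?_
    norm_cast
    linarith

lemma exists_vinterval_subset_span {I J : Set (Fin n)} (hI : I.Nonempty) (hJ : J.Nonempty)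
    (hdisj : Disjoint I J) (hunion : I ∪ J = Set.univ) {Vs : Set (Fin n → EReal)}
    (hfin : Vs.Finite) (hRmax : ∀ v ∈ Vs, IsRmax v) (hcover : ∀ l : Fin n, ∃ v ∈ Vs, v l ≠ ⊥)
    {w : Fin n → ℝ} {a : ℝ}
    (hw : ∀ l, shapley (fun l => if l ∈ I then J else I) Vs (ofReal w) l ≤ (a : EReal) + w l) :
    ∃ c : Fin n → ℝ, vinterval J c ((-a : ℝ) : EReal) ⊆ span Vs := by
  have hstep := fun l => exists_bsup_le_of_shapley_le hfin hRmax (hcover l) (hw l)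
  obtain ⟨g, hg, hgR, hgI, hgJ⟩ := exists_mem_span_separating (Q := J) hI hRmax (w := w) (a := a)
    fun l hl => by simpa only [hl, if_true] using hstep l
  obtain ⟨h, hh, hhR, hhJ, hhI⟩ := exists_mem_span_separating (Q := I) hJ hRmax (w := w) (a := a)
    fun l hl => by simpa only [Set.disjoint_right.1 hdisj hl, if_false] using hstep l
  refine ⟨fun l => if l ∈ J then (h l).toReal else (g l).toReal, ?_⟩
  rintro y ⟨lam, mu, h₁, h₂, rfl⟩
  norm_cast at h₁ h₂
  have hspan := (isTropCone_span Vs).1 _ ((isTropCone_span Vs).2 g hg lam (EReal.coe_ne_top _)) _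
    ((isTropCone_span Vs).2 h hh ((lam + mu : ℝ) : EReal) (EReal.coe_ne_top _))
  convert hspan using 1
  funext l
  rcases (hunion.symm ▸ Set.mem_univ l : l ∈ I ∪ J) with hl | hl
  · have hlJ := Set.disjoint_left.1 hdisj hl
    have hl' := hgI l hl
    obtain ⟨p, hp⟩ := exists_coe_eq hgR ((EReal.bot_lt_coe _).trans_le hl').ne'
    simp only [ofReal, hlJ, if_false, add_zero, hp, EReal.toReal_coe] at hl' ⊢
    rw [sup_of_le_left, EReal.coe_add]
    refine (add_le_add_right (hhI l hl) _).trans ?_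
    norm_cast at hl' ⊢
    linarith
  · have hl' := hhJ l hl
    obtain ⟨p, hp⟩ := exists_coe_eq hhR ((EReal.bot_lt_coe _).trans_le hl').ne'
    simp only [ofReal, hl, if_true, hp, EReal.toReal_coe] at hl' ⊢
    rw [sup_of_le_right]
    · norm_cast
      ring
    refine (add_le_add_right (hgJ l hl) _).trans ?_
    norm_cast at hl' ⊢
    linarith

end Span

section Duality

variable {I J : Set (Fin n)} {Vs : Set (Fin n → EReal)}

lemma sub_eigenvector_iff (hdisj : Disjoint I J) (hunion : I ∪ J = Set.univ)
    (hRmax : ∀ v ∈ Vs, IsRmax v) {a : ℝ} {b : Fin n → EReal} :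
    (∀ l, (a : EReal) + b l ≤ shapley (fun l => if l ∈ I then J else I) Vs b l) ↔
      ∀ v ∈ Vs, (a : EReal) + bsup I v b ≤ bsup J v b ∧
        (a : EReal) + bsup J v b ≤ bsup I v b := by
  simp only [le_shapley_iff hRmax]
  constructor
  · intro h v hv
    constructor <;> rw [coe_add_le_iff] <;> refine bsup_le_iff.2 fun l hl => ?_ <;>
      rw [← coe_add_le_iff, add_left_comm]
    · by_cases hvl : v l = ⊥
      · simp [hvl]
      · simpa [hl] using h l v hv hvl
    · by_cases hvl : v l = ⊥
      · simp [hvl]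
      · simpa [Set.disjoint_right.1 hdisj hl] using h l v hv hvl
  · intro h l v hv _
    rw [add_left_comm]
    rcases (hunion.symm ▸ Set.mem_univ l : l ∈ I ∪ J) with hl | hl
    · rw [if_pos hl]
      exact (add_le_add_right (le_bsup v b hl) _).trans (h v hv).1
    · rw [if_neg (Set.disjoint_right.1 hdisj hl)]
      exact (add_le_add_right (le_bsup v b hl) _).trans (h v hv).2

lemma nonpos_of_sub_eigenvector (hunion : I ∪ J = Set.univ)
    (hRmax : ∀ v ∈ Vs, IsRmax v) (hcover : ∀ l : Fin n, ∃ v ∈ Vs, v l ≠ ⊥) {a : ℝ}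
    {b : Fin n → EReal} (hb : IsRmax b) (hb0 : b ≠ ⊥)
    (h : ∀ v ∈ Vs, (a : EReal) + bsup I v b ≤ bsup J v b ∧
      (a : EReal) + bsup J v b ≤ bsup I v b) : a ≤ 0 := by
  obtain ⟨l, hl⟩ : ∃ l, b l ≠ ⊥ := by
    by_contra! h
    exact hb0 (funext h)
  obtain ⟨v, hv, hvl⟩ := hcover l
  have hAB : ¬ (bsup I v b = ⊥ ∧ bsup J v b = ⊥) := by
    rintro ⟨hA, hB⟩
    have h0 : v l + b l ≤ ⊥ := by
      rcases (hunion.symm ▸ Set.mem_univ l : l ∈ I ∪ J) with h | h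
      · exact (le_bsup _ _ h).trans hA.le
      · exact (le_bsup _ _ h).trans hB.le
    exact (EReal.add_eq_bot_iff.1 (le_bot_iff.1 h0)).elim hvl hl
  obtain ⟨h₁, h₂⟩ := h v hv
  have hA := bsup_ne_top (S := I) (hRmax v hv) hb
  have hB := bsup_ne_top (S := J) (hRmax v hv) hb
  generalize bsup I v b = A at *
  generalize bsup J v b = B at *
  induction A <;> induction B <;> simp_all [-EReal.coe_neg]
  all_goals norm_cast at h₁ h₂
  linarith

lemma neg_rhoOp_le_distHS [Nonempty (Fin n)] (hdisj : Disjoint I J) (hunion : I ∪ J = Set.univ)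
    (hfin : Vs.Finite) (hRmax : ∀ v ∈ Vs, IsRmax v) (hcover : ∀ l : Fin n, ∃ v ∈ Vs, v l ≠ ⊥)
    {a : Fin n → EReal} (ha : IsRmax a) (ha0 : a ≠ ⊥) :
    -rhoOp (shapley (fun l => if l ∈ I then J else I) Vs) ≤ distHS Vs (shyper I J a) := by
  refine EReal.le_of_forall_lt_iff_le.1 fun t ht => ?_
  rw [EReal.neg_le, ← EReal.coe_neg]
  refine le_rhoOp_shapley hfin hRmax hcover ha ha0
    ((sub_eigenvector_iff hdisj hunion hRmax).2 fun v hv => ?_)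
  obtain ⟨x, hx, hlt⟩ : ∃ x ∈ shyper I J a, hd v x < t := by
    simpa only [distPt, iInf_lt_iff, exists_prop] using
      (le_iSup₂ (f := fun v _ => distPt v (shyper I J a)) v hv).trans_lt ht
  have hx' := (mem_shyper_iff.1 hx).2
  exact ⟨add_bsup_le_of_hd_lt hx' hlt, add_bsup_le_of_hd_lt hx'.symm hlt⟩

lemma distHS_shyper_le (hdisj : Disjoint I J) (hunion : I ∪ J = Set.univ)
    (hRmax : ∀ v ∈ Vs, IsRmax v) (hcover : ∀ l : Fin n, ∃ v ∈ Vs, v l ≠ ⊥) {a : ℝ}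
    {b : Fin n → EReal} (hb : IsRmax b) (hb0 : b ≠ ⊥)
    (hsub : ∀ l, (a : EReal) + b l ≤ shapley (fun l => if l ∈ I then J else I) Vs b l) :
    distHS Vs (shyper I J b) ≤ ((-a : ℝ) : EReal) := by
  have h := (sub_eigenvector_iff hdisj hunion hRmax).1 hsub
  have ha := nonpos_of_sub_eigenvector hunion hRmax hcover hb hb0 h
  exact iSup₂_le fun v hv => distPt_shyper_le hdisj (hRmax v hv) hb ha (h v hv).1 (h v hv).2

end Duality

end SignedDuality

/-- **strong duality for signed tropical linear regression.**
`min_a dist_H(𝒱, H^{IJ}_a) = -ρ(T^{IJ}) = sup{r ≥ 0 : ∃ w ∈ ℝ^n, B_{IJ}(w,r) ⊆ Sp(𝒱)}`;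
the minimum is attained by any `b ≠ ⊥` with `T^{IJ}(b) ≥ ρ(T^{IJ}) + b` (and such `b`
exists); and if `ρ(T^{IJ})` is finite, there is `c ∈ ℝ^n` with
`B_{IJ}(c, -ρ(T^{IJ})) ⊆ Sp(𝒱)`. -/
theorem stmt18 {n : ℕ} (I J : Set (Fin n)) (hI : I.Nonempty) (hJ : J.Nonempty)
    (hdisj : Disjoint I J) (hunion : I ∪ J = Set.univ)
    (Vs : Set (Fin n → EReal)) (hfin : Vs.Finite)
    (hRmax : ∀ v ∈ Vs, IsRmax v)
    (hcover : ∀ l : Fin n, ∃ v ∈ Vs, v l ≠ ⊥) :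
    (⨅ a ∈ { a : Fin n → EReal | IsRmax a ∧ a ≠ ⊥ }, distHS Vs (shyper I J a))
        = -(rhoOp (TIJ I J Vs)) ∧
    (-(rhoOp (TIJ I J Vs)) = sSup { r : EReal | ∃ s : ℝ, r = (s : EReal) ∧ 0 ≤ s ∧
        ∃ w : Fin n → ℝ, vinterval J w r ⊆ span Vs }) ∧
    (∃ b : Fin n → EReal, IsRmax b ∧ b ≠ ⊥ ∧
        ∀ l, rhoOp (TIJ I J Vs) + b l ≤ TIJ I J Vs b l) ∧
    (∀ b : Fin n → EReal, IsRmax b → b ≠ ⊥ →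
      (∀ l, rhoOp (TIJ I J Vs) + b l ≤ TIJ I J Vs b l) →
        distHS Vs (shyper I J b) = -(rhoOp (TIJ I J Vs))) ∧
    (rhoOp (TIJ I J Vs) ≠ ⊥ → rhoOp (TIJ I J Vs) ≠ ⊤ →
      ∃ c : Fin n → ℝ, vinterval J c (-(rhoOp (TIJ I J Vs))) ⊆ span Vs) := by
  have : Nonempty (Fin n) := ⟨hI.some⟩
  rw [TIJ_eq_shapley]
  have hlower : ∀ a : Fin n → EReal, IsRmax a → a ≠ ⊥ → _ ≤ distHS Vs (shyper I J a) :=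
    fun a ha ha0 => neg_rhoOp_le_distHS hdisj hunion hfin hRmax hcover ha ha0
  have hcone : ∀ {a : ℝ} {w : Fin n → ℝ},
      (∀ l, shapley (fun l => if l ∈ I then J else I) Vs (ofReal w) l ≤ (a : EReal) + w l) →
      ∃ c : Fin n → ℝ, vinterval J c ((-a : ℝ) : EReal) ⊆ span Vs := fun hw =>
    exists_vinterval_subset_span hI hJ hdisj hunion hfin hRmax hcover hw
  rcases rhoOp_shapley_cases (O := fun l => if l ∈ I then J else I) hfin hRmax hcover with
    ⟨hrho, hw⟩ | ⟨a, hrho, ⟨b, hb, hb0, hsub⟩, w, hw⟩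
  · rw [hrho, EReal.neg_bot] at hlower ⊢
    refine ⟨?_, ?_, ⟨0, fun i => ?_, fun h => ?_, fun l => ?_⟩, fun b hb hb0 _ => ?_,
      fun h => (h rfl).elim⟩
    · exact top_le_iff.1 (le_iInf₂ fun a ha => hlower a ha.1 ha.2)
    · symm
      rw [EReal.eq_top_iff_forall_lt]
      intro r
      obtain ⟨w, hw⟩ := hw (-(max r 0 + 1))
      have hr : 0 ≤ max r 0 := le_max_right _ _
      obtain ⟨c, hc⟩ := hcone hw
      rw [neg_neg] at hc
      refine lt_of_lt_of_le (EReal.coe_lt_coe_iff.2 ?_)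
        (le_sSup ⟨max r 0 + 1, rfl, by linarith, c, hc⟩)
      linarith [le_max_left r 0]
    · simp
    · simpa using congrFun h hI.some
    · simp
    · exact top_le_iff.1 (hlower b hb hb0)
  · have hpair := (sub_eigenvector_iff hdisj hunion hRmax).1 hsub
    have ha := nonpos_of_sub_eigenvector hunion hRmax hcover hb hb0 hpair
    obtain ⟨c, hc⟩ := hcone hw
    rw [hrho, ← EReal.coe_neg] at hlower ⊢
    have hattain : ∀ b : Fin n → EReal, IsRmax b → b ≠ ⊥ →
        (∀ l, (a : EReal) + b l ≤ shapley (fun l => if l ∈ I then J else I) Vs b l) →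
        distHS Vs (shyper I J b) = ((-a : ℝ) : EReal) := fun b hb hb0 h =>
      le_antisymm (distHS_shyper_le hdisj hunion hRmax hcover hb hb0 h) (hlower b hb hb0)
    refine ⟨le_antisymm ?_ (le_iInf₂ fun a ha => hlower a ha.1 ha.2), le_antisymm ?_ ?_,
      ⟨b, hb, hb0, hsub⟩, hattain, fun _ _ => ⟨c, hc⟩⟩
    · exact (iInf₂_le b ⟨hb, hb0⟩).trans (hattain b hb hb0 hsub).le
    · exact le_sSup ⟨-a, rfl, by linarith, c, hc⟩
    · refine sSup_le ?_
      rintro _ ⟨r, rfl, hr, w, hw⟩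
      have := le_neg_of_vinterval_subset_span hdisj hunion hb hb0 (fun v hv => (hpair v hv).1)
        (fun v hv => (hpair v hv).2) hr hw
      exact EReal.coe_le_coe_iff.2 (by linarith)

end TropReg
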